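/- Let F be a field of characteristic different from two, and let p and q be anisotropic forms over F of dimension at least two. If q becomes hyperbolic over F(p), then a·p is a subform of b·q for all a ∈ D_F(p) and all b ∈ D_F(q). -/

import Mathlib

set_option synthInstance.maxHeartbeats 1000000
set_option maxHeartbeats 4000000

open scoped BigOperators Classical

namespace QF

section Defs

variable {R : Type*} [CommRing R]

/-- Evaluation of the diagonal quadratic form with coefficients `d` at the vector `v`. -/
def evalQF {n : ℕ} (d : Fin n → R) (v : Fin n → R) : R := ∑ i, d i * v i ^ 2

/-- A form is isotropic if it represents zero non-trivially. -/
def Isotropic {n : ℕ} (d : Fin n → R) : Prop := ∃ v : Fin n → R, v ≠ 0 ∧ evalQF d v = 0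

def Anisotropic {n : ℕ} (d : Fin n → R) : Prop := ¬ Isotropic d

/-- Nondegeneracy of a diagonal form: all coefficients are nonzero. -/
def Nondeg {n : ℕ} (d : Fin n → R) : Prop := ∀ i, d i ≠ 0

/-- Two diagonal forms are isometric if a linear equivalence matches their values. -/
def Isometric {m n : ℕ} (d : Fin m → R) (e : Fin n → R) : Prop :=
  ∃ φ : (Fin m → R) ≃ₗ[R] (Fin n → R), ∀ v, evalQF e (φ v) = evalQF d v

/-- Orthogonal sum of diagonal forms. -/
def osum {m n : ℕ} (d : Fin m → R) (e : Fin n → R) : Fin (m + n) → R := Fin.append d e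

/-- Tensor product of diagonal forms. -/
def tensorQF {m n : ℕ} (d : Fin m → R) (e : Fin n → R) : Fin (m * n) → R :=
  fun i => d (finProdFinEquiv.symm i).1 * e (finProdFinEquiv.symm i).2

/-- Scaling of a form by a scalar. -/
def smulQF {n : ℕ} (a : R) (d : Fin n → R) : Fin n → R := fun i => a * d i

/-- `k` copies of the hyperbolic plane `⟨1,-1⟩`. -/
def hypform {R : Type*} [CommRing R] (k : ℕ) : Fin (k + k) → R :=
  Fin.append (fun _ => 1) (fun _ => -1)

/-- A form is hyperbolic if it is isometric to a sum of hyperbolic planes,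
i.e. its Witt index is half its dimension. -/
def IsHyperbolic {n : ℕ} (d : Fin n → R) : Prop := ∃ k : ℕ, Isometric d (hypform k)

/-- The Witt index: the largest `k` such that `d ≅ k×⟨1,-1⟩ ⊥ r`. -/
noncomputable def WittIndex {n : ℕ} (d : Fin n → R) : ℕ :=
  sSup {k : ℕ | ∃ (m : ℕ) (r : Fin m → R), Isometric d (osum (hypform k) r)}

/-- `r` is a subform of `d`: `d ≅ r ⊥ s` for some (nondegenerate) form `s`. -/
def Subform {m n : ℕ} (r : Fin m → R) (d : Fin n → R) : Prop :=
  ∃ (k : ℕ) (s : Fin k → R), Nondeg s ∧ Isometric d (osum r s)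

/-- The set of nonzero represented values. -/
def Dset {n : ℕ} (d : Fin n → R) : Set R :=
  {a | a ≠ 0 ∧ ∃ v : Fin n → R, evalQF d v = a}

/-- The group of similarity factors `G(q) = {a : a·q ≅ q}`. -/
def Gset {n : ℕ} (d : Fin n → R) : Set R :=
  {a | a ≠ 0 ∧ Isometric (smulQF a d) d}

/-- `H(q) = {a : ⟨1,-a⟩ ⊗ q is isotropic}`. -/
def Hset {n : ℕ} (d : Fin n → R) : Set R :=
  {a | a ≠ 0 ∧ Isotropic (tensorQF ![1, -a] d)}

/-- Base change of a form along a ring homomorphism (e.g. a field extension). -/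
def bc {S : Type*} [CommRing S] (f : R →+* S) {n : ℕ} (d : Fin n → R) : Fin n → S :=
  fun i => f (d i)

/-- The Pfister form `⟨1,a 0⟩ ⊗ ⋯ ⊗ ⟨1, a (n-1)⟩`: its `2^n` diagonal coefficients are
the products `∏_{j ∈ S} a j` over subsets `S` of the index set. -/
noncomputable def pfisterOf {n : ℕ} (a : Fin n → R) : Fin (2 ^ n) → R :=
  fun i => ∏ j : Fin n, if (finFunctionFinEquiv.symm i) j = 0 then 1 else a j

/-- `π` is an `n`-fold Pfister form. -/
def IsNPfister (n : ℕ) {m : ℕ} (π : Fin m → R) : Prop :=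
  ∃ a : Fin n → R, (∀ i, a i ≠ 0) ∧ Isometric π (pfisterOf a)

/-- `π` is a Pfister form. -/
def IsPfister {m : ℕ} (π : Fin m → R) : Prop := ∃ n : ℕ, IsNPfister n π

end Defs

/-- The quadric polynomial `p(X₁,…,Xₙ) = ∑ dᵢ Xᵢ²` attached to a diagonal form. -/
noncomputable def formPoly {F : Type*} [CommRing F] {n : ℕ} (d : Fin n → F) :
    MvPolynomial (Fin n) F :=
  ∑ i, MvPolynomial.C (d i) * MvPolynomial.X i ^ 2

/-- The affine coordinate ring `F[X₁,…,Xₙ]/(p(X))` of the quadric `p = 0`. -/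
abbrev CoordRing {F : Type*} [CommRing F] {n : ℕ} (d : Fin n → F) : Type _ :=
  MvPolynomial (Fin n) F ⧸ Ideal.span {formPoly d}

/-- The function field `F(p)` of the quadric `p = 0`: the total fraction ring of the
coordinate ring (the quotient field when the coordinate ring is a domain, i.e. when `p` is
anisotropic of dimension at least 2). -/
abbrev FunField {F : Type*} [Field F] {n : ℕ} (d : Fin n → F) : Type _ :=
  FractionRing (CoordRing d)

end QF

namespace QF

open Polynomial

section DiagBilin

variable {R S : Type*} [CommRing R] [CommRing S] {N : ℕ}

/-- The symmetric bilinear form `(x, y) ↦ ∑ dᵢ xᵢ yᵢ` of the diagonal form `d`. -/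
def diagBilin (d : Fin N → R) : (Fin N → R) →ₗ[R] (Fin N → R) →ₗ[R] R :=
  LinearMap.mk₂ R (fun x y => ∑ i, d i * x i * y i)
    (fun x y z => by simp only [Pi.add_apply, ← Finset.sum_add_distrib]; congr! 1; ring)
    (fun c x y => by
      simp only [Pi.smul_apply, smul_eq_mul, Finset.mul_sum]; congr! 1; ring)
    (fun x y z => by simp only [Pi.add_apply, ← Finset.sum_add_distrib]; congr! 1; ring)
    (fun c x y => by
      simp only [Pi.smul_apply, smul_eq_mul, Finset.mul_sum]; congr! 1; ring)

theorem diagBilin_apply (d x y : Fin N → R) : diagBilin d x y = ∑ i, d i * x i * y i := rfl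

theorem diagBilin_comm (d x y : Fin N → R) : diagBilin d x y = diagBilin d y x := by
  simp only [diagBilin_apply]; congr! 1; ring

theorem diagBilin_self (d x : Fin N → R) : diagBilin d x x = evalQF d x := by
  simp only [diagBilin_apply, evalQF]; congr! 1; ring

theorem diagBilin_bc (f : R →+* S) (d x y : Fin N → R) :
    diagBilin (bc f d) (bc f x) (bc f y) = f (diagBilin d x y) := by
  simp [diagBilin_apply, bc]

theorem Anisotropic.eq_zero {d x : Fin N → R} (hd : Anisotropic d) (hx : diagBilin d x x = 0) :
    x = 0 := by
  by_contra h
  exact hd ⟨x, h, by rw [← diagBilin_self, hx]⟩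

theorem evalQF_add_smul (d x y : Fin N → R) (t : R) :
    evalQF d (x + t • y) = evalQF d x + 2 * t * diagBilin d x y + t ^ 2 * evalQF d y := by
  simp only [← diagBilin_self, map_add, map_smul, LinearMap.add_apply, LinearMap.smul_apply,
    smul_eq_mul, diagBilin_comm d y x]
  ring

theorem coeff_diagBilin_C (d y : Fin N → R) (f : Fin N → R[X]) (n : ℕ) :
    (diagBilin (bc C d) f (bc C y)).coeff n = diagBilin d (fun i => (f i).coeff n) y := by
  simp only [diagBilin_apply, bc, finsetSum_coeff, coeff_mul_C, coeff_C_mul]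

theorem coeff_evalQF_of_natDegree_le {d : Fin N → R} {f : Fin N → R[X]} {n : ℕ}
    (hf : ∀ i, (f i).natDegree ≤ n) :
    (evalQF (bc C d) f).coeff (2 * n) = evalQF d (fun i => (f i).coeff n) := by
  simp only [evalQF, bc, finsetSum_coeff, coeff_C_mul]
  congr! 2 with i
  exact coeff_pow_of_natDegree_le (hf i)

theorem natDegree_evalQF_le {d : Fin N → R} {f : Fin N → R[X]} {n : ℕ}
    (hf : ∀ i, (f i).natDegree ≤ n) : (evalQF (bc C d) f).natDegree ≤ 2 * n := by
  refine natDegree_sum_le_of_forall_le _ _ fun i _ => ?_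
  exact (natDegree_C_mul_le _ _).trans (natDegree_pow_le_of_le 2 (hf i))

theorem natDegree_le_of_anisotropic {d : Fin N → R} (hd : Anisotropic d) {f : Fin N → R[X]}
    {n : ℕ} (hf : (evalQF (bc C d) f).natDegree ≤ 2 * n) (i : Fin N) : (f i).natDegree ≤ n := by
  by_contra! hi
  obtain ⟨j, -, hj⟩ := Finset.exists_max_image Finset.univ (fun i => (f i).natDegree)
    ⟨i, Finset.mem_univ i⟩
  have hnj : n < (f j).natDegree := hi.trans_le (hj i (Finset.mem_univ i))
  have h0 := coeff_evalQF_of_natDegree_le (d := d) (fun i => hj i (Finset.mem_univ i))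
  rw [coeff_eq_zero_of_natDegree_lt (by omega), ← diagBilin_self] at h0
  have h1 := congrFun (hd.eq_zero h0.symm) j
  simp only [coeff_natDegree, Pi.zero_apply, leadingCoeff_eq_zero] at h1
  simp [h1] at hnj

/-- An isotropic vector over `R[X]` has an isotropic vector over `R` as leading coefficient. -/
theorem exists_isotropic_of_polynomial (d : Fin N → R) (W : Set (Fin N → R)) {f : Fin N → R[X]}
    (hf : f ≠ 0) (h0 : evalQF (bc C d) f = 0) (hW : ∀ w ∈ W, diagBilin (bc C d) f (bc C w) = 0) :
    ∃ c : Fin N → R, c ≠ 0 ∧ evalQF d c = 0 ∧ ∀ w ∈ W, diagBilin d c w = 0 := by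
  obtain ⟨i, hi⟩ := Function.ne_iff.1 hf
  obtain ⟨j, hj0, hj⟩ := Finset.exists_max_image (Finset.univ.filter fun i => f i ≠ 0)
    (fun i => (f i).natDegree) ⟨i, by simpa using hi⟩
  have hle : ∀ i, (f i).natDegree ≤ (f j).natDegree := fun i => by
    by_cases h : f i = 0
    · simp [h]
    · exact hj i (by simpa using h)
  refine ⟨fun i => (f i).coeff (f j).natDegree, fun h => ?_, ?_, fun w hw => ?_⟩
  · have := congrFun h j
    simp only [coeff_natDegree, Pi.zero_apply, leadingCoeff_eq_zero] at this
    simp [this] at hj0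
  · rw [← coeff_evalQF_of_natDegree_le hle, h0, coeff_zero]
  · rw [← coeff_diagBilin_C, hW w hw, coeff_zero]

theorem Anisotropic.polynomial {d : Fin N → R} (hd : Anisotropic d) : Anisotropic (bc C d) := by
  rintro ⟨f, hf, h0⟩
  obtain ⟨c, hc, hc0, -⟩ := exists_isotropic_of_polynomial d ∅ hf h0 (by simp)
  exact hd ⟨c, hc, hc0⟩

theorem evalQF_bc (f : R →+* S) (d x : Fin N → R) :
    evalQF (bc f d) (bc f x) = f (evalQF d x) := by
  simp [evalQF, bc]

end DiagBilin

section Field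

variable {K : Type*} [Field K] {N : ℕ}

/-- The Cassels–Pfister theorem, with the representing vector constrained to the orthogonal
complement of a set of constant vectors. -/
theorem cassels_pfister {d : Fin N → K} (hd : Anisotropic d) (W : Set (Fin N → K)) (h : K[X])
    (f : Fin N → K[X]) (g : K[X]) (hg : g ≠ 0) (hfg : evalQF (bc C d) f = h * g ^ 2)
    (hW : ∀ w ∈ W, diagBilin (bc C d) f (bc C w) = 0) :
    ∃ u : Fin N → K[X], evalQF (bc C d) u = h ∧
      ∀ w ∈ W, diagBilin (bc C d) u (bc C w) = 0 := by
  induction hn : g.natDegree using Nat.strong_induction_on generalizing f g with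
  | _ n ih =>
  subst hn
  set u : Fin N → K[X] := fun i => f i / g with hu
  set r : Fin N → K[X] := fun i => f i % g with hr
  have hf : f = r + g • u := funext fun i => (EuclideanDomain.mod_add_div (f i) g).symm
  have hdeg : ∀ i, (r i).degree < g.degree := fun i => EuclideanDomain.mod_lt (f i) hg
  have hWru : ∀ w ∈ W, diagBilin (bc C d) r (bc C w) = 0 ∧ diagBilin (bc C d) u (bc C w) = 0 := by
    intro w hw
    have h1 := hW w hw
    rw [hf, map_add, map_smul, LinearMap.add_apply, LinearMap.smul_apply, smul_eq_mul] at h1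
    have h2 : (diagBilin (bc C d) r (bc C w)).degree < g.degree := by
      rw [diagBilin_apply]
      refine (degree_sum_le _ _).trans_lt ((Finset.sup_lt_iff
        (bot_lt_iff_ne_bot.2 (degree_ne_bot.2 hg))).2 fun i _ => ?_)
      have : bc C d i * r i * bc C w i = C (d i * w i) * r i := by
        simp only [bc, C_mul]; ring
      rw [this, C_mul']
      exact (degree_smul_le _ _).trans_lt (hdeg i)
    have h3 : diagBilin (bc C d) r (bc C w) = 0 :=
      eq_zero_of_dvd_of_degree_lt ⟨-diagBilin (bc C d) u (bc C w), by linear_combination h1⟩ h2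
    rw [h3, zero_add] at h1
    exact ⟨h3, (mul_eq_zero.1 h1).resolve_left hg⟩
  rw [hf, evalQF_add_smul] at hfg
  by_cases hr0 : r = 0
  · refine ⟨u, ?_, fun w hw => (hWru w hw).2⟩
    rw [hr0, ← diagBilin_self] at hfg
    simp only [map_zero, LinearMap.zero_apply] at hfg
    refine mul_left_cancel₀ (pow_ne_zero 2 hg) ?_
    linear_combination hfg
  set g' : K[X] := g * (h - evalQF (bc C d) u) - 2 * diagBilin (bc C d) r u with hg'
  have hgg : g * g' = evalQF (bc C d) r := by rw [hg']; linear_combination -hfg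
  have hq : evalQF (bc C d) r ≠ 0 := fun h0 => hd.polynomial ⟨r, hr0, h0⟩
  have hg0 : g' ≠ 0 := right_ne_zero_of_mul (hgg.trans_ne hq)
  have hlt : g'.natDegree < g.natDegree := by
    obtain ⟨i, hi⟩ := Function.ne_iff.1 hr0
    have hlt : ∀ j, (r j).natDegree < g.natDegree ∨ r j = 0 := fun j => by
      by_cases hj : r j = 0
      · exact .inr hj
      · exact .inl (natDegree_lt_natDegree hj (hdeg j))
    have hpos : 0 < g.natDegree := by
      rcases hlt i with hi' | hi'
      · omega
      · exact absurd hi' hi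
    have hle : ∀ j, (r j).natDegree ≤ g.natDegree - 1 := fun j => by
      rcases hlt j with hj | hj
      · omega
      · simp [hj]
    have h1 := natDegree_evalQF_le (d := d) hle
    rw [← hgg, natDegree_mul hg hg0] at h1
    omega
  refine ih _ hlt (g' • u + (evalQF (bc C d) u - h) • r) g' hg0 ?_ (fun w hw => ?_) rfl
  · rw [evalQF_add_smul, ← hgg, map_smul, LinearMap.smul_apply, diagBilin_comm _ u r,
      ← diagBilin_self _ (g' • u), map_smul, map_smul, LinearMap.smul_apply, diagBilin_self]
    simp only [smul_eq_mul]
    linear_combination g' * (evalQF (bc C d) u - h) * hg'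
  · simp [(hWru w hw).1, (hWru w hw).2]

/-- Reflections act transitively on the vectors of given norm in an anisotropic space. -/
theorem exists_orthogonal_transport {d : Fin N → K} (hd : Anisotropic d) (v w u : Fin N → K)
    (hvw : evalQF d v = evalQF d w) (huv : diagBilin d u v = 0) :
    ∃ u' : Fin N → K, evalQF d u' = evalQF d u ∧ diagBilin d u' w = 0 ∧
      ∀ x, diagBilin d v x = 0 → diagBilin d w x = 0 → diagBilin d u x = 0 →
        diagBilin d u' x = 0 := by
  by_cases h : v = w
  · exact ⟨u, rfl, h ▸ huv, fun x _ _ hx => hx⟩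
  set e := v + (-1 : K) • w with he
  have hq : evalQF d e ≠ 0 := fun h0 => hd ⟨e, fun h1 => h (by
    rw [he, neg_one_smul, ← sub_eq_add_neg] at h1; exact sub_eq_zero.1 h1), h0⟩
  have hqe : evalQF d e = 2 * (evalQF d w - diagBilin d v w) := by
    rw [he, evalQF_add_smul]; linear_combination hvw
  have hue : diagBilin d u e = - diagBilin d u w := by simp [he, huv]
  refine ⟨u + (-(2 * diagBilin d u e) / evalQF d e) • e, ?_, ?_, fun x h1 h2 h3 => ?_⟩
  · rw [evalQF_add_smul]; field_simp; ring
  · have hew : diagBilin d e w = - evalQF d e / 2 := by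
      have h2 : (2 : K) ≠ 0 := fun h2 => hq (by rw [hqe, h2, zero_mul])
      rw [hqe, ← diagBilin_self, he]; simp; field_simp; ring
    have h2 : (2 : K) ≠ 0 := fun h2 => hq (by rw [hqe, h2, zero_mul])
    rw [map_add, map_smul, LinearMap.add_apply, LinearMap.smul_apply, hew, hue, smul_eq_mul]
    field_simp; ring
  · simp [he, h1, h2, h3]

end Field

section RationalFunctions

theorem exists_isotropic_of_mvPolynomial {R : Type*} [CommRing R] {N : ℕ} (n : ℕ)
    (d : Fin N → R) (W : Set (Fin N → R)) {f : Fin N → MvPolynomial (Fin n) R}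
    (hf : f ≠ 0) (h0 : evalQF (bc MvPolynomial.C d) f = 0)
    (hW : ∀ w ∈ W, diagBilin (bc MvPolynomial.C d) f (bc MvPolynomial.C w) = 0) :
    ∃ c : Fin N → R, c ≠ 0 ∧ evalQF d c = 0 ∧ ∀ w ∈ W, diagBilin d c w = 0 := by
  induction n with
  | zero =>
    let e := (MvPolynomial.isEmptyAlgEquiv R (Fin 0)).toRingEquiv.toRingHom
    have he : ∀ x : Fin N → R, bc e (bc MvPolynomial.C x) = x := fun x =>
      funext fun i => (MvPolynomial.isEmptyAlgEquiv R (Fin 0)).commutes (x i)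
    refine ⟨bc e f, fun h => hf (funext fun i => ?_), ?_, fun w hw => ?_⟩
    · exact (MvPolynomial.isEmptyAlgEquiv R (Fin 0)).injective
        ((congrFun h i).trans (map_zero _).symm)
    · rw [← he d, evalQF_bc, h0, map_zero]
    · rw [← he d, ← he w, diagBilin_bc, hW w hw, map_zero]
  | succ n ih =>
    let e := (MvPolynomial.finSuccEquiv R n).toRingEquiv.toRingHom
    have he : ∀ x : Fin N → R, bc e (bc MvPolynomial.C x) = bc C (bc MvPolynomial.C x) := fun x =>
      funext fun i => (MvPolynomial.finSuccEquiv R n).commutes (x i)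
    obtain ⟨c, hc, hc0, hcW⟩ := exists_isotropic_of_polynomial (bc MvPolynomial.C d)
      (bc MvPolynomial.C '' W) (f := bc e f)
      (fun h => hf (funext fun i => (MvPolynomial.finSuccEquiv R n).injective
        ((congrFun h i).trans (map_zero _).symm)))
      (by rw [← he d, evalQF_bc, h0, map_zero])
      (by
        rintro _ ⟨w, hw, rfl⟩
        rw [← he d, ← he w, diagBilin_bc, hW w hw, map_zero])
    exact ih hc hc0 fun w hw => hcW _ ⟨w, hw, rfl⟩

/-- Clearing denominators of a vector. -/
theorem exists_bc_eq_smul {A K : Type*} [CommRing A] [IsDomain A] [Field K] [Algebra A K]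
    [IsFractionRing A K] {N : ℕ} (f : Fin N → K) :
    ∃ (g : A) (f' : Fin N → A), g ≠ 0 ∧ bc (algebraMap A K) f' = algebraMap A K g • f := by
  obtain ⟨b, hb⟩ := IsLocalization.exist_integer_multiples_of_finite (nonZeroDivisors A) f
  choose f' hf' using hb
  exact ⟨b, f', nonZeroDivisors.ne_zero b.2, funext fun i => by
    simp [bc, hf', Algebra.smul_def]⟩

theorem exists_isotropic_of_fractionRing {F : Type*} [Field F] {N n : ℕ} (d : Fin N → F)
    (W : Set (Fin N → F)) {f : Fin N → FractionRing (MvPolynomial (Fin n) F)} (hf : f ≠ 0)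
    (h0 : evalQF (bc (algebraMap F _) d) f = 0)
    (hW : ∀ w ∈ W, diagBilin (bc (algebraMap F _) d) f (bc (algebraMap F _) w) = 0) :
    ∃ c : Fin N → F, c ≠ 0 ∧ evalQF d c = 0 ∧ ∀ w ∈ W, diagBilin d c w = 0 := by
  let A := MvPolynomial (Fin n) F
  let K := FractionRing A
  obtain ⟨g, f', hg, hf'⟩ := exists_bc_eq_smul (A := A) f
  have hgK : algebraMap A K g ≠ 0 := by simpa using hg
  have hinj : Function.Injective (algebraMap A K) := IsFractionRing.injective A K
  have htower : ∀ x : Fin N → F,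
      bc (algebraMap F K) x = bc (algebraMap A K) (bc MvPolynomial.C x) := fun x =>
    funext fun i => IsScalarTower.algebraMap_apply F A K (x i)
  refine exists_isotropic_of_mvPolynomial n d W (f := f') (fun h => hf ?_) (hinj ?_)
    (fun w hw => hinj ?_)
  · have h1 : algebraMap A K g • f = 0 := by
      rw [← hf', h]; exact funext fun i => map_zero _
    exact (smul_eq_zero.1 h1).resolve_left hgK
  · rw [← evalQF_bc, hf', ← htower, ← diagBilin_self, map_smul, map_smul, LinearMap.smul_apply,
      diagBilin_self, h0]
    simp
  · rw [← diagBilin_bc, hf', ← htower, ← htower, map_smul, LinearMap.smul_apply, hW w hw]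
    simp

theorem Anisotropic.fractionRing {F : Type*} [Field F] {N : ℕ} {d : Fin N → F}
    (hd : Anisotropic d) (n : ℕ) :
    Anisotropic (bc (algebraMap F (FractionRing (MvPolynomial (Fin n) F))) d) := by
  rintro ⟨f, hf, h0⟩
  obtain ⟨c, hc, hc0, -⟩ := exists_isotropic_of_fractionRing d ∅ hf h0 (by simp)
  exact hd ⟨c, hc, hc0⟩

/-- A constant represented over a rational function field is represented over the base field. -/
theorem exists_evalQF_eq_of_fractionRing {F : Type*} [Field F] {N n : ℕ} {d : Fin N → F}
    (hd : Anisotropic d) (W : Set (Fin N → F)) (a : F)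
    {f : Fin N → FractionRing (MvPolynomial (Fin n) F)}
    (h0 : evalQF (bc (algebraMap F _) d) f = algebraMap F _ a)
    (hW : ∀ w ∈ W, diagBilin (bc (algebraMap F _) d) f (bc (algebraMap F _) w) = 0) :
    ∃ c : Fin N → F, evalQF d c = a ∧ ∀ w ∈ W, diagBilin d c w = 0 := by
  let K := FractionRing (MvPolynomial (Fin n) F)
  have hB : ∀ {R : Type _} [CommRing R] (e x y : Fin N → R) (b s t : R),
      diagBilin (Fin.cons b e : Fin (N + 1) → R) (Fin.cons s x) (Fin.cons t y)
        = b * s * t + diagBilin e x y := fun e x y b s t => by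
    simp [diagBilin_apply, Fin.sum_univ_succ]
  have hcons : ∀ (s : F) (x : Fin N → F), bc (algebraMap F K) (Fin.cons s x : Fin (N + 1) → F)
      = Fin.cons (algebraMap F K s) (bc (algebraMap F K) x) := fun s x => by
    funext i; refine Fin.cases ?_ (fun i => ?_) i <;> simp [bc]
  obtain ⟨c, hc, hc0, hcW⟩ := exists_isotropic_of_fractionRing (n := n)
    (Fin.cons (-a) d : Fin (N + 1) → F) ((fun w => (Fin.cons 0 w : Fin (N + 1) → F)) '' W)
    (f := Fin.cons 1 f) (fun h => one_ne_zero (congrFun h 0))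
    (by
      rw [hcons, ← diagBilin_self, hB, diagBilin_self, h0, map_neg, mul_one, mul_one]
      exact neg_add_cancel _)
    (by
      rintro _ ⟨w, hw, rfl⟩
      rw [hcons, hcons, hB, hW w hw]; simp)
  obtain ⟨s, x, rfl⟩ : ∃ s x, c = Fin.cons s x := ⟨c 0, Fin.tail c, (Fin.cons_self_tail c).symm⟩
  rw [← diagBilin_self, hB] at hc0
  have hs : s ≠ 0 := by
    rintro rfl
    have := hd.eq_zero (x := x) (by simpa using hc0)
    subst this
    exact hc (funext fun i => by refine Fin.cases ?_ (fun i => ?_) i <;> simp)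
  refine ⟨s⁻¹ • x, ?_, fun w hw => ?_⟩
  · rw [← diagBilin_self, map_smul, map_smul, LinearMap.smul_apply, smul_eq_mul, smul_eq_mul]
    field_simp
    linear_combination hc0
  · have := hcW _ ⟨w, hw, rfl⟩
    rw [hB] at this
    rw [map_smul, LinearMap.smul_apply, smul_eq_mul]
    simp at this
    simp [this]

theorem finSuccEquiv_formPoly {F : Type*} [Field F] {n : ℕ} (p : Fin (n + 1) → F) :
    MvPolynomial.finSuccEquiv F n (formPoly p) =
      C (MvPolynomial.C (p 0)) * X ^ 2 + C (formPoly (Fin.tail p)) := by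
  have h : ∀ a : F, MvPolynomial.finSuccEquiv F n (MvPolynomial.C a) = C (MvPolynomial.C a) :=
    (MvPolynomial.finSuccEquiv F n).commutes
  simp only [formPoly, Fin.sum_univ_succ, map_add, map_sum, map_mul, map_pow, h,
    MvPolynomial.finSuccEquiv_X_zero, MvPolynomial.finSuccEquiv_X_succ]
  rfl

/-- A binary family `a X² + c` represented over `K(X)` comes from orthogonal vectors over `K`. -/
theorem exists_orthogonal_of_represents {K : Type*} [Field K] (h2 : (2 : K) ≠ 0) {N : ℕ}
    {d : Fin N → K}
    (hd : Anisotropic d) (W : Set (Fin N → K)) (a c : K) (f : Fin N → K[X]) (g : K[X]) (hg : g ≠ 0)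
    (hfg : evalQF (bc C d) f = (C a * X ^ 2 + C c) * g ^ 2)
    (hW : ∀ w ∈ W, diagBilin (bc C d) f (bc C w) = 0) :
    ∃ v u : Fin N → K, evalQF d v = a ∧ evalQF d u = c ∧ diagBilin d u v = 0 ∧
      ∀ w ∈ W, diagBilin d v w = 0 ∧ diagBilin d u w = 0 := by
  obtain ⟨u, hu, huW⟩ := cassels_pfister hd W _ f g hg hfg hW
  have hdeg := natDegree_le_of_anisotropic hd (n := 1) (f := u) (by rw [hu]; compute_degree)
  have hu1 : u = bc C (fun i => (u i).coeff 0) + (X : K[X]) • bc C (fun i => (u i).coeff 1) := by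
    funext i
    have := eq_X_add_C_of_natDegree_le_one (hdeg i)
    simp only [Pi.add_apply, Pi.smul_apply, bc, smul_eq_mul]
    linear_combination this
  have h := hu
  rw [hu1, evalQF_add_smul, evalQF_bc, evalQF_bc, diagBilin_bc] at h
  rw [show C (evalQF d fun i => (u i).coeff 0) + 2 * X * C (diagBilin d (fun i => (u i).coeff 0)
      fun i => (u i).coeff 1) + X ^ 2 * C (evalQF d fun i => (u i).coeff 1) =
      C (evalQF d fun i => (u i).coeff 1) * X ^ 2 + C (2 * diagBilin d (fun i => (u i).coeff 0)
      fun i => (u i).coeff 1) * X + C (evalQF d fun i => (u i).coeff 0) by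
    rw [C_mul, show (C 2 : K[X]) = 2 from rfl]; ring] at h
  refine ⟨fun i => (u i).coeff 1, fun i => (u i).coeff 0, ?_, ?_, ?_, fun w hw => ?_⟩
  · simpa [coeff_X, coeff_C] using congrArg (fun q => q.coeff 2) h
  · simpa using congrArg (fun q => q.coeff 0) h
  · simpa [coeff_X, coeff_C, h2] using congrArg (fun q => q.coeff 1) h
  · rw [← coeff_diagBilin_C, ← coeff_diagBilin_C, huW w hw]
    simp

/-- If the generic value of `p` is represented by an anisotropic form `d` over the rational
function field, then `p` is a subform of `d`. -/
theorem exists_orthogonal_of_represents_generic {F : Type*} [Field F] (h2 : (2 : F) ≠ 0) {N : ℕ}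
    {d : Fin N → F} (hd : Anisotropic d) {n : ℕ} (p : Fin n → F) (W : Set (Fin N → F))
    (f : Fin N → FractionRing (MvPolynomial (Fin n) F))
    (hf : evalQF (bc (algebraMap F _) d) f = algebraMap (MvPolynomial (Fin n) F) _ (formPoly p))
    (hW : ∀ w ∈ W, diagBilin (bc (algebraMap F _) d) f (bc (algebraMap F _) w) = 0) :
    ∃ y : Fin n → Fin N → F, (∀ i, evalQF d (y i) = p i) ∧
      (∀ i j, i ≠ j → diagBilin d (y i) (y j) = 0) ∧ ∀ i, ∀ w ∈ W, diagBilin d (y i) w = 0 := by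
  induction n generalizing W with
  | zero => exact ⟨Fin.elim0, fun i => i.elim0, fun i => i.elim0, fun i => i.elim0⟩
  | succ n ih =>
    let A := MvPolynomial (Fin n) F
    let K := FractionRing A
    let A' := MvPolynomial (Fin (n + 1)) F
    let K' := FractionRing A'
    have htower' : ∀ x : Fin N → F,
        bc (algebraMap F K') x = bc (algebraMap A' K') (bc MvPolynomial.C x) := fun x =>
      funext fun i => IsScalarTower.algebraMap_apply F A' K' (x i)
    have hinj : Function.Injective (algebraMap A' K') := IsFractionRing.injective A' K'
    obtain ⟨g, f', hg, hf'⟩ := exists_bc_eq_smul (A := A') f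
    have hf1 : evalQF (bc MvPolynomial.C d) f' = formPoly p * g ^ 2 := hinj (by
      rw [← evalQF_bc, hf', ← htower', ← diagBilin_self, map_smul, map_smul, LinearMap.smul_apply,
        diagBilin_self, hf, smul_eq_mul, smul_eq_mul, map_mul, map_pow]
      ring)
    have hW1 : ∀ w ∈ W, diagBilin (bc MvPolynomial.C d) f' (bc MvPolynomial.C w) = 0 :=
      fun w hw => hinj (by
        rw [← diagBilin_bc, hf', ← htower', ← htower', map_smul, LinearMap.smul_apply, hW w hw]
        simp)
    let θ : A' →+* K[X] :=
      (mapRingHom (algebraMap A K)).comp (MvPolynomial.finSuccEquiv F n).toRingEquiv.toRingHom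
    have hθ : ∀ a, θ a = (MvPolynomial.finSuccEquiv F n a).map (algebraMap A K) := fun _ => rfl
    have hθC : ∀ x : Fin N → F, bc θ (bc MvPolynomial.C x) = bc C (bc (algebraMap F K) x) := by
      refine fun x => funext fun i => ?_
      have : MvPolynomial.finSuccEquiv F n (MvPolynomial.C (x i)) = C (MvPolynomial.C (x i)) :=
        (MvPolynomial.finSuccEquiv F n).commutes (x i)
      simp only [bc, hθ, this, map_C]
      rfl
    have hθg : θ g ≠ 0 := by
      rw [hθ]
      refine (Polynomial.map_ne_zero_iff (IsFractionRing.injective A K)).2 ?_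
      simpa using hg
    have hθp : θ (formPoly p) =
        C (algebraMap F K (p 0)) * X ^ 2 + C (algebraMap A K (formPoly (Fin.tail p))) := by
      rw [hθ, finSuccEquiv_formPoly]
      simp only [Polynomial.map_add, Polynomial.map_mul, map_C, Polynomial.map_pow, map_X]
      rfl
    have hdK := hd.fractionRing n
    have h2K : (2 : K) ≠ 0 := fun h =>
      h2 ((map_eq_zero (algebraMap F K)).1 ((map_ofNat _ 2).trans h))
    obtain ⟨v, u, hv, hu, huv, hvuW⟩ := exists_orthogonal_of_represents h2K hdK
      (bc (algebraMap F K) '' W) _ _ (bc θ f') (θ g) hθg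
      (by rw [← hθC, evalQF_bc, hf1, map_mul, map_pow, hθp])
      (by
        rintro _ ⟨w, hw, rfl⟩
        rw [← hθC, ← hθC, diagBilin_bc, hW1 w hw, map_zero])
    obtain ⟨y₀, hy₀, hy₀W⟩ := exists_evalQF_eq_of_fractionRing hd W (p 0) hv
      fun w hw => (hvuW _ ⟨w, hw, rfl⟩).1
    obtain ⟨u', hu', hu'y, hu'W⟩ := exists_orthogonal_transport hdK v (bc (algebraMap F K) y₀) u
      (by rw [hv, evalQF_bc, hy₀]) huv
    obtain ⟨y, hy, hyy, hyW⟩ := ih (Fin.tail p) (insert y₀ W) u' (hu'.trans hu) (by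
      rintro w (rfl | hw)
      · exact hu'y
      · exact hu'W _ (hvuW _ ⟨w, hw, rfl⟩).1 (by rw [diagBilin_bc, hy₀W w hw, map_zero])
          (hvuW _ ⟨w, hw, rfl⟩).2)
    refine ⟨Fin.cons y₀ y, Fin.cases hy₀ hy, fun i j => ?_, Fin.cases hy₀W fun i w hw =>
      hyW i w (Set.mem_insert_of_mem _ hw)⟩
    refine Fin.cases (Fin.cases (fun h => (h rfl).elim) (fun j _ => ?_) j)
      (fun i => Fin.cases (fun _ => ?_) (fun j h => ?_) j) i
    · rw [diagBilin_comm]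
      exact hyW j y₀ (Set.mem_insert _ _)
    · exact hyW i y₀ (Set.mem_insert _ _)
    · exact hyy i j fun hij => h (congrArg Fin.succ hij)

end RationalFunctions

section Hyperbolic

/-- A hyperbolic form of dimension `2k` has a totally isotropic family of size `k` admitting a
dual family. -/
theorem IsHyperbolic.exists_isotropic_family {R : Type*} [CommRing R] [Nontrivial R]
    (h2 : IsUnit (2 : R)) {N : ℕ} {d : Fin N → R} (h : IsHyperbolic d) :
    ∃ k, N = k + k ∧ ∃ E Λ : Fin k → Fin N → R,
      (∀ i j, diagBilin d (E i) (E j) = 0) ∧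
      ∀ i j, ∑ t, Λ i t * E j t = if i = j then 1 else 0 := by
  obtain ⟨k, φ, hφ⟩ := h
  have hN : N = k + k := by simpa using φ.finrank_eq
  have hφB : ∀ x y, diagBilin (hypform k) (φ x) (φ y) = diagBilin d x y := fun x y => by
    have h1 := hφ (x + (1 : R) • y)
    rw [map_add, map_smul, evalQF_add_smul, evalQF_add_smul, hφ, hφ] at h1
    refine h2.mul_left_cancel ?_
    linear_combination h1
  let e : Fin k → Fin (k + k) → R := fun i => Fin.append (Pi.single i 1) (Pi.single i 1)
  refine ⟨k, hN, fun i => φ.symm (e i), fun i t => φ (Pi.single t 1) (Fin.castAdd k i),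
    fun i j => ?_, fun i j => ?_⟩
  · rw [← hφB]
    simp only [LinearEquiv.apply_symm_apply, diagBilin_apply, Fin.sum_univ_add, hypform, e,
      Fin.append_left, Fin.append_right, one_mul, neg_mul, Finset.sum_neg_distrib]
    exact add_neg_cancel _
  · have h1 : φ (φ.symm (e j)) (Fin.castAdd k i) = if i = j then 1 else 0 := by
      simp [e, Pi.single_apply]
    rw [← h1]
    conv_rhs => rw [pi_eq_sum_univ' (φ.symm (e j)), map_sum]
    simp only [map_smul, Finset.sum_apply, Pi.smul_apply, smul_eq_mul]
    refine Finset.sum_congr rfl fun t _ => ?_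
    rw [mul_comm]

/-- If an anisotropic form acquires a totally isotropic subspace of half its dimension over
`K(√δ)`, then every vector is the rational part of a vector of that subspace. -/
theorem exists_of_isotropic_family {K : Type*} [Field K] (h2 : (2 : K) ≠ 0) {δ : K}
    [hδ : Fact (∀ r : K, r ^ 2 ≠ δ + 0 * r)] {k : ℕ} {q : Fin (k + k) → K} (hq : Anisotropic q)
    {E Λ : Fin k → Fin (k + k) → QuadraticAlgebra K δ 0}
    (hE : ∀ i j, diagBilin (bc (algebraMap K (QuadraticAlgebra K δ 0)) q) (E i) (E j) = 0)
    (hΛ : ∀ i j, ∑ t, Λ i t * E j t = if i = j then 1 else 0) (x : Fin (k + k) → K) :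
    ∃ y, diagBilin q x y = 0 ∧ evalQF q x + δ * evalQF q y = 0 := by
  let L := QuadraticAlgebra K δ 0
  have hδ0 : δ ≠ 0 := fun h => hδ.out 0 (by simp [h])
  let ω : (Fin k → L) →ₗ[K] (Fin (k + k) → L) :=
    (Fintype.linearCombination L E).restrictScalars K
  have hω : ∀ c, ω c = ∑ i, c i • E i := fun c => rfl
  have hiso : ∀ c, diagBilin (bc (algebraMap K L) q) (ω c) (ω c) = 0 := fun c => by
    rw [hω]
    simp [map_sum, LinearMap.sum_apply, L, hE]
  have hre : ∀ c, evalQF q (fun t => (ω c t).re) + δ * evalQF q (fun t => (ω c t).im) = 0 := by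
    intro c
    have := congrArg (QuadraticAlgebra.reₗ δ 0) (hiso c)
    rw [diagBilin_apply, map_sum, map_zero] at this
    refine Eq.trans ?_ this
    rw [evalQF, evalQF, Finset.mul_sum, ← Finset.sum_add_distrib]
    refine Finset.sum_congr rfl fun t _ => ?_
    simp [QuadraticAlgebra.reₗ, bc, L]
    ring
  have him : ∀ c, diagBilin q (fun t => (ω c t).re) (fun t => (ω c t).im) = 0 := by
    intro c
    have := congrArg (QuadraticAlgebra.imₗ δ 0) (hiso c)
    rw [diagBilin_apply, map_sum, map_zero] at this
    refine (mul_eq_zero.1 (?_ : (2 : K) * _ = 0)).resolve_left h2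
    refine Eq.trans ?_ this
    rw [diagBilin_apply, Finset.mul_sum]
    refine Finset.sum_congr rfl fun t _ => ?_
    simp [QuadraticAlgebra.imₗ, bc, L]
    ring
  let ψ : (Fin k → L) →ₗ[K] (Fin (k + k) → K) := (QuadraticAlgebra.reₗ δ 0).compLeft _ ∘ₗ ω
  have hψ : ∀ c, ψ c = fun t => (ω c t).re := fun c => rfl
  have hinj : Function.Injective ψ := by
    rw [injective_iff_map_eq_zero]
    intro c hc
    rw [hψ] at hc
    have h1 := hre c
    rw [hc, ← diagBilin_self, ← diagBilin_self, map_zero, zero_add] at h1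
    have h3 := hq.eq_zero ((mul_eq_zero.1 h1).resolve_left hδ0)
    have h4 : ω c = 0 := funext fun t =>
      QuadraticAlgebra.ext (congrFun hc t) (congrFun h3 t)
    funext i
    have h5 : ∑ t, Λ i t * ω c t = c i := by
      simp only [hω, Finset.sum_apply, Pi.smul_apply, smul_eq_mul, Finset.mul_sum]
      rw [Finset.sum_comm]
      have : ∀ j, ∑ t, Λ i t * (c j * E j t) = c j * ∑ t, Λ i t * E j t := fun j => by
        rw [Finset.mul_sum]; congr! 1; ring
      simp [this, hΛ]
    rw [← h5, h4]
    simp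
  have hfr : Module.finrank K (Fin k → L) = Module.finrank K (Fin (k + k) → K) := by
    rw [Module.finrank_pi_fintype]
    simp [L, QuadraticAlgebra.finrank_eq_two]
    ring
  obtain ⟨c, rfl⟩ := (LinearMap.injective_iff_surjective_of_finrank_eq_finrank hfr).1 hinj x
  exact ⟨fun t => (ω c t).im, him c, hre c⟩

/-- The function field of `a X₀² + p'` maps to the quadratic extension `K(√δ)` of the rational
function field `K` in the remaining variables, where `a δ = -p'`. -/
theorem exists_ringHom_funField {F : Type*} [Field F] {m : ℕ} {p : Fin (m + 1) → F}
    (hp : p 0 ≠ 0) {δ : FractionRing (MvPolynomial (Fin m) F)}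
    (hδ : algebraMap F _ (p 0) * δ = -algebraMap (MvPolynomial (Fin m) F) _ (formPoly (Fin.tail p)))
    [Fact (∀ r, r ^ 2 ≠ δ + 0 * r)] :
    ∃ θ : FunField p →+* QuadraticAlgebra (FractionRing (MvPolynomial (Fin m) F)) δ 0,
      ∀ a : F, θ (algebraMap F (FunField p) a) =
        algebraMap (FractionRing (MvPolynomial (Fin m) F)) (QuadraticAlgebra _ δ 0)
          (algebraMap F _ a) := by
  let A := MvPolynomial (Fin m) F
  let K := FractionRing A
  let L := QuadraticAlgebra K δ 0
  let δ' : A := -(MvPolynomial.C (p 0)⁻¹ * formPoly (Fin.tail p))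
  have hp0 : algebraMap F K (p 0) ≠ 0 := (_root_.map_ne_zero _).2 hp
  have hC : ∀ a, algebraMap A K (MvPolynomial.C a) = algebraMap F K a := fun a => rfl
  have hδ' : algebraMap A K δ' = δ := mul_left_cancel₀ hp0 (by
    rw [hδ, map_neg, map_mul, hC, map_inv₀, mul_neg, mul_inv_cancel_left₀ hp0])
  let M : A[X] := X ^ 2 - C δ'
  have hM : M.Monic := monic_X_pow_sub_C δ' two_ne_zero
  have hpM : MvPolynomial.finSuccEquiv F m (formPoly p) = C (MvPolynomial.C (p 0)) * M := by
    have : MvPolynomial.C (p 0) * δ' = - formPoly (Fin.tail p) := by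
      rw [mul_neg, ← mul_assoc, ← map_mul, mul_inv_cancel₀ hp, map_one, one_mul]
    rw [finSuccEquiv_formPoly, mul_sub, ← C_mul, this, C_neg, sub_neg_eq_add]
  let ε : A[X] →+* L := eval₂RingHom ((algebraMap K L).comp (algebraMap A K)) QuadraticAlgebra.omega
  have hεM : ε M = 0 := by
    simp only [ε, M, coe_eval₂RingHom, eval₂_sub, eval₂_X_pow, eval₂_C, RingHom.comp_apply, hδ']
    rw [sq, QuadraticAlgebra.omega_mul_omega_eq_mk]
    exact sub_self _
  have hε : ∀ f, ε f = 0 → M ∣ f := by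
    intro f hf
    rw [← modByMonic_eq_zero_iff_dvd hM]
    have h1 : ε (f %ₘ M) = 0 := by
      rw [modByMonic_eq_sub_mul_div f M, map_sub, map_mul, hεM, hf, zero_mul, sub_zero]
    have h2 : (f %ₘ M).natDegree ≤ 1 := by
      have h3 : M.natDegree = 2 := natDegree_X_pow_sub_C
      have := natDegree_modByMonic_lt f hM fun h => by simp [h] at h3
      omega
    rw [eq_X_add_C_of_natDegree_le_one h2] at h1 ⊢
    simp only [ε, coe_eval₂RingHom, eval₂_add, eval₂_mul, eval₂_X, eval₂_C,
      RingHom.comp_apply] at h1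
    have h3 : (f %ₘ M).coeff 0 = 0 := by simpa [L] using congrArg QuadraticAlgebra.re h1
    have h4 : (f %ₘ M).coeff 1 = 0 := by simpa [L] using congrArg QuadraticAlgebra.im h1
    rw [h3, h4, map_zero, zero_mul, zero_add]
  let η : MvPolynomial (Fin (m + 1)) F →+* L :=
    ε.comp (MvPolynomial.finSuccEquiv F m).toRingEquiv.toRingHom
  have hηa : ∀ f, η f = ε (MvPolynomial.finSuccEquiv F m f) := fun _ => rfl
  have hη : ∀ f ∈ Ideal.span {formPoly p}, η f = 0 := fun f hf => by
    obtain ⟨c, rfl⟩ := Ideal.mem_span_singleton'.1 hf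
    rw [map_mul, hηa (formPoly p), hpM, map_mul, hεM, mul_zero, mul_zero]
  let η' : CoordRing p →+* L := Ideal.Quotient.lift _ η hη
  have hη' : Function.Injective η' := by
    refine RingHom.lift_injective_of_ker_le_ideal _ hη fun f hf => ?_
    obtain ⟨c, hc⟩ := hε _ hf
    rw [Ideal.mem_span_singleton']
    refine ⟨(MvPolynomial.finSuccEquiv F m).symm (C (MvPolynomial.C (p 0)⁻¹) * c),
      (MvPolynomial.finSuccEquiv F m).injective ?_⟩
    have h1 : (C (MvPolynomial.C (p 0)⁻¹) * C (MvPolynomial.C (p 0)) : A[X]) = 1 := by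
      rw [← C_mul, ← map_mul, inv_mul_cancel₀ hp, map_one, map_one]
    rw [map_mul, AlgEquiv.apply_symm_apply, hpM]
    refine Eq.trans ?_ hc.symm
    linear_combination M * c * h1
  have : Nontrivial (CoordRing p) := η'.domain_nontrivial
  have hunit : ∀ y : nonZeroDivisors (CoordRing p), IsUnit (η' y) := fun y =>
    IsUnit.mk0 _ ((map_ne_zero_iff η' hη').2 (nonZeroDivisors.ne_zero y.2))
  refine ⟨IsLocalization.lift hunit, fun a => ?_⟩
  rw [IsScalarTower.algebraMap_apply F (CoordRing p) (FunField p), IsLocalization.lift_eq]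
  have h1 : η' (algebraMap F (CoordRing p) a) = η (MvPolynomial.C a) := rfl
  have h3 : MvPolynomial.finSuccEquiv F m (MvPolynomial.C a) = C (MvPolynomial.C a) :=
    (MvPolynomial.finSuccEquiv F m).commutes a
  rw [h1, hηa, h3]
  simp only [ε, coe_eval₂RingHom, eval₂_C]
  rfl

end Hyperbolic

section Subform

theorem evalQF_sum_smul {F : Type*} [Field F] {n N : ℕ} {q : Fin N → F} {w : Fin n → Fin N → F}
    (hw : ∀ i j, i ≠ j → diagBilin q (w i) (w j) = 0) (x : Fin n → F) :
    evalQF q (∑ i, x i • w i) = evalQF (fun i => evalQF q (w i)) x := by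
  rw [← diagBilin_self, map_sum, evalQF]
  refine Finset.sum_congr rfl fun i _ => ?_
  rw [map_sum, LinearMap.sum_apply,
    Finset.sum_eq_single i (fun j _ hj => by simp [hw j i hj]) (by simp)]
  simp only [map_smul, LinearMap.smul_apply, smul_eq_mul, diagBilin_self]
  ring

/-- An orthogonal family with values `c i ≠ 0` in an anisotropic space of form `d` exhibits `c` as
a subform of `d`. -/
theorem subform_of_orthogonal {F : Type*} [Field F] (h2 : (2 : F) ≠ 0) {n N : ℕ} {c : Fin n → F}
    {d : Fin N → F} (hd : Anisotropic d) (hc : Nondeg c) {z : Fin n → Fin N → F}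
    (hz : ∀ i, evalQF d (z i) = c i) (hzz : ∀ i j, i ≠ j → diagBilin d (z i) (z j) = 0) :
    Subform c d := by
  let T : (Fin N → F) →ₗ[F] (Fin n → F) := LinearMap.pi fun i => diagBilin d (z i)
  let U := LinearMap.ker T
  have hU : ∀ u : U, ∀ i, diagBilin d (z i) u = 0 := fun u i => congrFun u.2 i
  let BU : LinearMap.BilinForm F U := (diagBilin d).compl₁₂ U.subtype U.subtype
  have hsymm : LinearMap.IsSymm BU := ⟨fun u v => diagBilin_comm d u v⟩
  have : Invertible (2 : F) := invertibleOfNonzero h2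
  obtain ⟨v, hv⟩ := LinearMap.BilinForm.exists_orthogonal_basis hsymm
  let k := Module.finrank F U
  let s : Fin k → F := fun j => evalQF d (v j)
  have hs : Nondeg s := fun j h => by
    have h1 : (v j : Fin N → F) = 0 := hd.eq_zero (by rw [diagBilin_self]; exact h)
    exact v.ne_zero j (Subtype.ext h1)
  let e : Fin (n + k) → Fin N → F := Fin.append z fun j => (v j : Fin N → F)
  have heval : ∀ i, evalQF d (e i) = osum c s i := fun i => by
    refine Fin.addCases (fun i => ?_) (fun i => ?_) i
    · simp only [e, osum, Fin.append_left, hz]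
    · simp only [e, osum, Fin.append_right, s]
  have hnd : ∀ i, osum c s i ≠ 0 := fun i => by
    refine Fin.addCases (fun i => ?_) (fun i => ?_) i
    · simpa only [osum, Fin.append_left] using hc i
    · simpa only [osum, Fin.append_right] using hs i
  have horth : ∀ i j, i ≠ j → diagBilin d (e i) (e j) = 0 := by
    intro i j
    refine Fin.addCases (fun i => ?_) (fun i => ?_) i <;>
      refine Fin.addCases (fun j => ?_) (fun j => ?_) j <;>
      simp only [e, Fin.append_left, Fin.append_right] <;> intro hij
    · exact hzz i j fun h => hij (by rw [h])
    · exact hU _ _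
    · rw [diagBilin_comm]; exact hU _ _
    · exact hv fun h => hij (by rw [h])
  have hsum : ∀ x : Fin (n + k) → F, evalQF d (∑ i, x i • e i) = evalQF (osum c s) x := fun x => by
    rw [evalQF_sum_smul horth]
    simp only [heval]
  have hli : LinearIndependent F e := by
    refine LinearMap.linearIndependent_of_isOrthoᵢ (B := diagBilin d)
      (fun i j hij => horth i j hij) fun i h => hnd i ?_
    rw [← heval, ← diagBilin_self]
    exact h
  have hcard : Fintype.card (Fin (n + k)) = Module.finrank F (Fin N → F) := by
    refine le_antisymm hli.fintype_card_le_finrank ?_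
    have h1 := T.finrank_range_add_finrank_ker
    have h3 := (LinearMap.range T).finrank_le
    simp only [Module.finrank_fin_fun] at h3
    rw [← h1, Fintype.card_fin]
    exact Nat.add_le_add_right h3 _
  let b : Module.Basis (Fin (n + k)) F (Fin N → F) :=
    Module.Basis.mk hli (hli.span_eq_top_of_card_eq_finrank' hcard).ge
  refine ⟨k, s, hs, b.equivFun, fun x => ?_⟩
  rw [← hsum]
  congr 1
  conv_rhs => rw [← b.sum_equivFun x]
  simp [b]

end Subform

section SubformTheorem

variable {F : Type*} [Field F] {m N : ℕ} {p : Fin (m + 1) → F} {q : Fin N → F}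

theorem fact_sq_ne_of_anisotropic (hpan : Anisotropic p) (hm : 1 ≤ m)
    {δ : FractionRing (MvPolynomial (Fin m) F)}
    (hδ : algebraMap F _ (p 0) * δ =
      -algebraMap (MvPolynomial (Fin m) F) _ (formPoly (Fin.tail p))) :
    Fact (∀ r, r ^ 2 ≠ δ + 0 * r) := by
  refine ⟨fun r hr => hpan.fractionRing m ⟨Fin.cons r fun i =>
    algebraMap (MvPolynomial (Fin m) F) _ (MvPolynomial.X i), fun h => ?_, ?_⟩⟩
  · have h1 := congrFun h (Fin.succ ⟨0, hm⟩)
    rw [Fin.cons_succ, Pi.zero_apply, IsFractionRing.to_map_eq_zero_iff] at h1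
    exact MvPolynomial.X_ne_zero _ h1
  · have h1 : algebraMap (MvPolynomial (Fin m) F) (FractionRing (MvPolynomial (Fin m) F))
        (formPoly (Fin.tail p)) = ∑ i : Fin m, algebraMap F _ (p i.succ) *
          (algebraMap (MvPolynomial (Fin m) F) _ (MvPolynomial.X i)) ^ 2 := by
      simp only [formPoly, map_sum, map_mul, map_pow]
      rfl
    rw [evalQF, Fin.sum_univ_succ]
    simp only [bc, Fin.cons_zero, Fin.cons_succ]
    rw [← h1, hr, zero_mul, add_zero, hδ, neg_add_cancel]

/-- If `q` becomes hyperbolic over the function field of `p`, then for every vector `β` there is an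
orthogonal family in the space of `q` with values `q(β) p₀ pᵢ`. -/
theorem exists_orthogonal_of_isHyperbolic_funField (h2 : (2 : F) ≠ 0) (hm : 1 ≤ m)
    (hp : Nondeg p) (hpan : Anisotropic p) (hqan : Anisotropic q)
    (hhyp : IsHyperbolic (bc (algebraMap F (FunField p)) q)) (β : Fin N → F) :
    ∃ w : Fin (m + 1) → Fin N → F, (∀ i, evalQF q (w i) = evalQF q β * p 0 * p i) ∧
      ∀ i j, i ≠ j → diagBilin q (w i) (w j) = 0 := by
  let K := FractionRing (MvPolynomial (Fin m) F)
  have hp0 : algebraMap F K (p 0) ≠ 0 := (_root_.map_ne_zero _).2 (hp 0)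
  obtain ⟨δ, hδ⟩ : ∃ δ : K, algebraMap F K (p 0) * δ =
      -algebraMap (MvPolynomial (Fin m) F) K (formPoly (Fin.tail p)) :=
    ⟨_, mul_div_cancel₀ _ hp0⟩
  have := fact_sq_ne_of_anisotropic hpan hm hδ
  obtain ⟨θ, hθ⟩ := exists_ringHom_funField (hp 0) hδ
  have : Nontrivial (FunField p) := θ.domain_nontrivial
  have h2' : IsUnit (2 : FunField p) := by
    rw [← map_ofNat (algebraMap F (FunField p)) 2]
    exact (IsUnit.mk0 _ h2).map _
  obtain ⟨k, rfl, E, Λ, hE, hΛ⟩ := hhyp.exists_isotropic_family h2'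
  have hbc : bc (algebraMap K (QuadraticAlgebra K δ 0)) (bc (algebraMap F K) q) =
      bc θ (bc (algebraMap F (FunField p)) q) := funext fun i => (hθ (q i)).symm
  obtain ⟨y, hβy, hy⟩ := exists_of_isotropic_family (K := K) (δ := δ)
    (E := fun i => bc θ (E i)) (Λ := fun i => bc θ (Λ i))
    (q := bc (algebraMap F K) q) (by
      rw [← map_ofNat (algebraMap F K) 2]
      exact (_root_.map_ne_zero _).2 h2)
    (hqan.fractionRing m)
    (fun i j => by rw [hbc, diagBilin_bc, hE, map_zero])
    (fun i j => by
      simp only [bc, ← map_mul, ← map_sum, hΛ, apply_ite θ, map_one, map_zero])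
    (bc (algebraMap F K) β)
  let φ : K := algebraMap (MvPolynomial (Fin m) F) K (formPoly (Fin.tail p))
  have hf : evalQF (bc (algebraMap F K) q) (φ • y) =
      algebraMap (MvPolynomial (Fin m) F) K
        (formPoly fun i => evalQF q β * p 0 * p i.succ) := by
    have h3 : formPoly (fun i : Fin m => evalQF q β * p 0 * p i.succ) =
        MvPolynomial.C (evalQF q β * p 0) * formPoly (Fin.tail p) := by
      simp only [formPoly, Finset.mul_sum, Fin.tail, map_mul, mul_assoc]
    have h4 : evalQF (bc (algebraMap F K) q) (bc (algebraMap F K) β) =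
        algebraMap F K (evalQF q β) := by
      rw [← diagBilin_self, diagBilin_bc, diagBilin_self]
    have h5 : ∀ a, algebraMap (MvPolynomial (Fin m) F) K (MvPolynomial.C a) = algebraMap F K a :=
      fun a => rfl
    rw [h4] at hy
    rw [h3, map_mul, h5, map_mul, ← diagBilin_self]
    simp only [map_smul, LinearMap.smul_apply, smul_eq_mul, diagBilin_self]
    linear_combination φ * evalQF (bc (algebraMap F K) q) y * hδ - algebraMap F K (p 0) * φ * hy
  obtain ⟨w, hw, hww, hwβ⟩ := exists_orthogonal_of_represents_generic h2 hqan _ {β} _ hf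
    fun w hw => by
      rw [Set.mem_singleton_iff.1 hw, map_smul, LinearMap.smul_apply, diagBilin_comm, hβy,
        smul_zero]
  refine ⟨Fin.cons (p 0 • β) w, fun i => ?_, fun i j => ?_⟩
  · refine Fin.cases ?_ (fun i => ?_) i
    · rw [Fin.cons_zero, ← diagBilin_self, map_smul, map_smul, LinearMap.smul_apply,
        diagBilin_self, smul_eq_mul, smul_eq_mul]
      ring
    · rw [Fin.cons_succ, hw]
  · refine Fin.cases ?_ (fun i => ?_) i <;> refine Fin.cases ?_ (fun j => ?_) j <;> intro hij
    · exact absurd rfl hij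
    · rw [Fin.cons_zero, Fin.cons_succ, diagBilin_comm, map_smul, hwβ j β rfl, smul_zero]
    · rw [Fin.cons_zero, Fin.cons_succ, map_smul, hwβ i β rfl, smul_zero]
    · rw [Fin.cons_succ, Fin.cons_succ, hww i j fun h => hij (by rw [h])]

theorem evalQF_smulQF (b : F) (v : Fin N → F) : evalQF (smulQF b q) v = b * evalQF q v := by
  simp only [evalQF, smulQF, Finset.mul_sum, mul_assoc]

theorem diagBilin_smulQF (b : F) (v w : Fin N → F) :
    diagBilin (smulQF b q) v w = b * diagBilin q v w := by
  simp only [diagBilin_apply, smulQF, Finset.mul_sum, mul_assoc]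

theorem subform_of_isHyperbolic_funField (h2 : (2 : F) ≠ 0) (hm : 1 ≤ m)
    (hp : Nondeg p) (hpan : Anisotropic p) (hqan : Anisotropic q)
    (hhyp : IsHyperbolic (bc (algebraMap F (FunField p)) q)) {a b : F} (ha : a ∈ Dset p)
    (hb : b ∈ Dset q) : Subform (smulQF a p) (smulQF b q) := by
  obtain ⟨ha0, u, hu⟩ := ha
  obtain ⟨hb0, β, hβ⟩ := hb
  obtain ⟨w, hw, hww⟩ :=
    exists_orthogonal_of_isHyperbolic_funField h2 hm hp hpan hqan hhyp β
  obtain ⟨z, hz, hzz⟩ :=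
    exists_orthogonal_of_isHyperbolic_funField h2 hm hp hpan hqan hhyp (∑ i, u i • w i)
  have hval : evalQF q (∑ i, u i • w i) = b * p 0 * a := by
    rw [evalQF_sum_smul hww, ← hu, evalQF, evalQF, Finset.mul_sum]
    simp only [hw, hβ, mul_assoc]
  have hp0 := hp 0
  refine subform_of_orthogonal h2 (z := fun i => (p 0 * b)⁻¹ • z i) ?_
    (fun i => mul_ne_zero ha0 (hp i)) (fun i => ?_) (fun i j hij => ?_)
  · rintro ⟨v, hv, h⟩
    rw [evalQF_smulQF] at h
    exact hqan ⟨v, hv, (mul_eq_zero.1 h).resolve_left hb0⟩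
  · rw [evalQF_smulQF, ← diagBilin_self, map_smul, map_smul, LinearMap.smul_apply,
      diagBilin_self, hz, hval, smul_eq_mul, smul_eq_mul, smulQF]
    field_simp
  · rw [diagBilin_smulQF, map_smul, map_smul, LinearMap.smul_apply, hzz i j hij, smul_zero,
      smul_zero, mul_zero]

end SubformTheorem

end QF


open QF in
/-- The Cassels–Pfister subform theorem: if `p` and `q` are anisotropic forms over `F`
(char `F ≠ 2`) of dimension at least two and `q` becomes hyperbolic over `F(p)`, then
`a·p ⊆ b·q` for all `a ∈ D_F(p)` and all `b ∈ D_F(q)`. -/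
theorem stmt_16 {F : Type*} [Field F] (h2 : (2 : F) ≠ 0)
    {np nq : ℕ} (p : Fin np → F) (q : Fin nq → F)
    (hp : Nondeg p) (hq : Nondeg q) (hp2 : 2 ≤ np) (hq2 : 2 ≤ nq)
    (hpan : Anisotropic p) (hqan : Anisotropic q)
    (hhyp : IsHyperbolic (bc (algebraMap F (FunField p)) q)) :
    ∀ a ∈ Dset p, ∀ b ∈ Dset q, Subform (smulQF a p) (smulQF b q) := by
  intro a ha b hb
  obtain ⟨m, rfl⟩ : ∃ m, np = m + 1 := ⟨np - 1, by omega⟩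
  exact subform_of_isHyperbolic_funField h2 (by omega) hp hpan hqan hhyp ha hb
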